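/- Let f : A → B be a homomorphism of abelian groups such that there exists a positive integer m annihilating both the kernel of f and the cokernel of f (that is, m • x = 0 for all x ∈ ker f and m • y = 0 for all y ∈ coker f). Then for every prime ℓ, the induced map Hom_ℤ(ℚ_ℓ/ℤ_ℓ, A) ⊗_ℤ ℚ → Hom_ℤ(ℚ_ℓ/ℤ_ℓ, B) ⊗_ℤ ℚ, obtained from postcomposition with f by tensoring with ℚ, is an isomorphism. -/

import Mathlib

/-- The Prüfer `ℓ`-group `ℚ_ℓ/ℤ_ℓ`: the quotient of the additive group of the `ℓ`-adic
numbers by the additive subgroup given by the `ℓ`-adic integers. -/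
noncomputable def PadicQuotient (ℓ : ℕ) [Fact ℓ.Prime] : Type :=
  ℚ_[ℓ] ⧸ (LinearMap.range (Algebra.linearMap ℤ_[ℓ] ℚ_[ℓ]))

noncomputable instance (ℓ : ℕ) [Fact ℓ.Prime] : AddCommGroup (PadicQuotient ℓ) :=
  inferInstanceAs (AddCommGroup (ℚ_[ℓ] ⧸ (LinearMap.range (Algebra.linearMap ℤ_[ℓ] ℚ_[ℓ]))))

open scoped TensorProduct

/-- The map `T_ℓ(A) → T_ℓ(B)` on Tate modules induced by `f : A → B` via postcomposition. -/
noncomputable def tateMap (ℓ : ℕ) [Fact ℓ.Prime] {A B : Type*} [AddCommGroup A]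
    [AddCommGroup B] (f : A →+ B) : (PadicQuotient ℓ →+ A) →+ (PadicQuotient ℓ →+ B) where
  toFun φ := f.comp φ
  map_zero' := by ext x; simp
  map_add' := fun φ ψ => by ext x; simp

/-- A homomorphism whose kernel and cokernel are annihilated by `m` has an inverse up to
multiplication by `m * m`. -/
theorem exists_quasi_inverse {A B : Type*} [AddCommGroup A] [AddCommGroup B] (f : A →+ B)
    (m : ℕ) (hker : ∀ a : A, f a = 0 → m • a = 0) (hcoker : ∀ b : B, ∃ a : A, f a = m • b) :
    ∃ g : B →+ A, (∀ a, g (f a) = (m * m) • a) ∧ ∀ b, f (g b) = (m * m) • b := by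
  choose c hc using hcoker
  have hf : ∀ a a' : A, f a = f a' → m • a = m • a' := fun a a' h => by
    rw [← sub_eq_zero, ← smul_sub]
    exact hker _ (by rw [map_sub, h, sub_self])
  refine ⟨AddMonoidHom.mk' (fun b => m • c b) fun b b' => ?_, fun a => ?_, fun b => ?_⟩
  · rw [← smul_add]
    exact hf _ _ (by rw [map_add, hc, hc, hc, smul_add])
  · rw [mul_smul]
    exact hf _ _ (by rw [hc, map_nsmul])
  · simp only [AddMonoidHom.mk'_apply, map_nsmul, hc, mul_smul]

/-- An additive map that is invertible up to multiplication by a nonzero `n` becomes bijective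
after tensoring with `ℚ`. -/
theorem bijective_map_id_rat_of_quasi_inverse {M N : Type*} [AddCommGroup M] [AddCommGroup N]
    (f : M →ₗ[ℤ] N) (g : N →ₗ[ℤ] M) {n : ℕ} (hn : n ≠ 0)
    (hgf : ∀ x, g (f x) = n • x) (hfg : ∀ y, f (g y) = n • y) :
    Function.Bijective (TensorProduct.map f (LinearMap.id : ℚ →ₗ[ℤ] ℚ)) := by
  have hq : ∀ q : ℚ, n • ((n : ℚ)⁻¹ * q) = q := fun q => by
    rw [nsmul_eq_mul, mul_inv_cancel_left₀ (Nat.cast_ne_zero.mpr hn)]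
  refine Function.bijective_iff_has_inverse.mpr
    ⟨TensorProduct.map g (LinearMap.mulLeft ℤ (n : ℚ)⁻¹), fun x => ?_, fun y => ?_⟩
  · induction x with
    | zero => simp only [map_zero]
    | add x y hx hy => simp only [map_add, hx, hy]
    | tmul x q =>
      simp only [TensorProduct.map_tmul, LinearMap.id_apply, LinearMap.mulLeft_apply, hgf,
        TensorProduct.smul_tmul, hq]
  · induction y with
    | zero => simp only [map_zero]
    | add x y hx hy => simp only [map_add, hx, hy]
    | tmul x q =>
      simp only [TensorProduct.map_tmul, LinearMap.id_apply, LinearMap.mulLeft_apply, hfg,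
        TensorProduct.smul_tmul, hq]

/-- if `f : A → B` is a homomorphism of abelian groups whose kernel and cokernel
are both annihilated by some positive integer `m`, then for every prime `ℓ` the induced map
`V_ℓ(f) : T_ℓ(A) ⊗ ℚ → T_ℓ(B) ⊗ ℚ` on rational Tate modules is an isomorphism. -/
theorem statement12 {A B : Type*} [AddCommGroup A] [AddCommGroup B] (f : A →+ B)
    (m : ℕ) (hm : 0 < m)
    (hker : ∀ a : A, f a = 0 → m • a = 0)
    (hcoker : ∀ b : B, ∃ a : A, f a = m • b)
    (ℓ : ℕ) [Fact ℓ.Prime] :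
    Function.Bijective
      (TensorProduct.map ((tateMap ℓ f).toIntLinearMap) (LinearMap.id : ℚ →ₗ[ℤ] ℚ) :
        ((PadicQuotient ℓ →+ A) ⊗[ℤ] ℚ) →ₗ[ℤ] ((PadicQuotient ℓ →+ B) ⊗[ℤ] ℚ)) := by
  obtain ⟨g, hgf, hfg⟩ := exists_quasi_inverse f m hker hcoker
  exact bijective_map_id_rat_of_quasi_inverse (tateMap ℓ f).toIntLinearMap
    (tateMap ℓ g).toIntLinearMap (Nat.mul_pos hm hm).ne'
    (fun φ => AddMonoidHom.ext fun x => hgf (φ x))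
    (fun φ => AddMonoidHom.ext fun x => hfg (φ x))
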